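/- Let E_0 be the equivalence relation of eventual equality on Cantor space: x E_0 y iff there is n such that x(m) = y(m) for all m ≥ n. Suppose that every E_0-invariant subset of Cantor space has the perfect set property. Then every subset of Cantor space has the perfect set property. -/

import Mathlib

/-- A set of reals has the perfect set property if it is countable or
contains a nonempty perfect subset. -/
def PerfectSetProperty (A : Set (ℕ → Bool)) : Prop :=
  A.Countable ∨ ∃ P ⊆ A, Perfect P ∧ P.Nonempty

/-- The equivalence relation `E₀` of eventual equality on Cantor space. -/
def E0 (x y : ℕ → Bool) : Prop := ∃ n : ℕ, ∀ m ≥ n, x m = y m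

/-- Repeat every coordinate of a sequence infinitely often. -/
def repeatCoords (x : ℕ → Bool) (n : ℕ) : Bool := x n.unpair.2

/-- Flip the coordinates of a sequence lying in a finite set. -/
def flipOn (s : Finset ℕ) (x : ℕ → Bool) (n : ℕ) : Bool := xor (x n) (decide (n ∈ s))

theorem continuous_repeatCoords : Continuous repeatCoords :=
  continuous_pi fun n => continuous_apply n.unpair.2

theorem continuous_flipOn (s : Finset ℕ) : Continuous (flipOn s) :=
  continuous_pi fun n =>
    (continuous_of_discreteTopology (f := fun b : Bool => xor b (decide (n ∈ s)))).comp
      (continuous_apply n)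

theorem E0.symm {x y : ℕ → Bool} (h : E0 x y) : E0 y x :=
  let ⟨n, hn⟩ := h
  ⟨n, fun m hm => (hn m hm).symm⟩

theorem E0.trans {x y z : ℕ → Bool} (hxy : E0 x y) (hyz : E0 y z) : E0 x z := by
  obtain ⟨n, hn⟩ := hxy
  obtain ⟨k, hk⟩ := hyz
  exact ⟨max n k, fun m hm =>
    (hn m (le_of_max_le_left hm)).trans (hk m (le_of_max_le_right hm))⟩

theorem eq_of_E0_repeatCoords {x y : ℕ → Bool} (h : E0 (repeatCoords x) (repeatCoords y)) :
    x = y := by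
  obtain ⟨n, hn⟩ := h
  ext1 i
  simpa [repeatCoords] using hn (Nat.pair n i) (Nat.left_le_pair n i)

theorem E0_flipOn (s : Finset ℕ) (x : ℕ → Bool) : E0 x (flipOn s x) := by
  refine ⟨s.sup id + 1, fun m hm => ?_⟩
  have hms : m ∉ s := fun h => by
    have := Finset.le_sup (f := id) h
    simp only [id] at this
    omega
  simp [flipOn, hms]

theorem exists_flipOn_eq {x y : ℕ → Bool} (h : E0 x y) : ∃ s : Finset ℕ, flipOn s x = y := by
  obtain ⟨n, hn⟩ := h
  refine ⟨(Finset.range n).filter fun m => x m ≠ y m, funext fun m => ?_⟩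
  by_cases hxy : x m = y m
  · simp [flipOn, hxy]
  · have hm : m < n := by
      by_contra hm
      exact hxy (hn m (not_lt.mp hm))
    cases hx : x m <;> cases hy : y m <;> simp_all [flipOn]

theorem Perfect.not_countable_cantor {P : Set (ℕ → Bool)} (hP : Perfect P) (hne : P.Nonempty) :
    ¬ P.Countable := by
  let := TopologicalSpace.upgradeIsCompletelyMetrizable (ℕ → Bool)
  obtain ⟨g, hg, -, hinj⟩ := hP.exists_nat_bool_injection hne
  intro hc
  have huniv : (Set.univ : Set (ℕ → Bool)).Countable :=
    Set.countable_of_injective_of_countable_image hinj.injOn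
      (hc.mono (by rwa [Set.image_univ]))
  have hunc : Uncountable (ℕ → Bool) :=
    Cardinal.aleph0_lt_mk_iff.mp (by simp [Cardinal.aleph0_lt_continuum])
  exact not_countable_iff.mpr hunc (Set.countable_univ_iff.mp huniv)

/-- If every `E₀`-invariant subset of Cantor space has the perfect set property,
then every subset of Cantor space has the perfect set property. -/
theorem E0_invariant_psp_implies_psp
    (h : ∀ A : Set (ℕ → Bool),
      (∀ x ∈ A, ∀ y : ℕ → Bool, E0 x y → y ∈ A) → PerfectSetProperty A) :
    ∀ A : Set (ℕ → Bool), PerfectSetProperty A := by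
  intro A
  rcases h {y | ∃ a ∈ A, E0 (repeatCoords a) y}
    (fun x ⟨a, ha, hax⟩ y hxy => ⟨a, ha, hax.trans hxy⟩) with hc | ⟨P, hPA, hP, hne⟩
  · left
    refine Set.countable_of_injective_of_countable_image (f := repeatCoords) ?_ (hc.mono ?_)
    · intro x _ y _ hxy
      exact eq_of_E0_repeatCoords ⟨0, fun m _ => congrFun hxy m⟩
    · rintro _ ⟨a, ha, rfl⟩
      exact ⟨a, ha, 0, fun _ _ => rfl⟩
  · right
    let C : Finset ℕ → Set (ℕ → Bool) := fun s => (fun x => flipOn s (repeatCoords x)) ⁻¹' P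
    have hC : ∃ s, ¬ (C s).Countable := by
      by_contra! hcount
      refine hP.not_countable_cantor hne ((Set.countable_iUnion fun s =>
        (hcount s).image fun x => flipOn s (repeatCoords x)).mono ?_)
      intro p hp
      obtain ⟨a, -, hap⟩ := hPA hp
      obtain ⟨s, rfl⟩ := exists_flipOn_eq hap
      exact Set.mem_iUnion.mpr ⟨s, a, hp, rfl⟩
    obtain ⟨s, hs⟩ := hC
    have hclosed : IsClosed (C s) :=
      hP.closed.preimage ((continuous_flipOn s).comp continuous_repeatCoords)
    obtain ⟨D, hD, hDne, hDC⟩ := exists_perfect_nonempty_of_isClosed_of_not_countable hclosed hs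
    refine ⟨D, fun x hx => ?_, hD, hDne⟩
    obtain ⟨a, ha, hax⟩ := hPA (hDC hx)
    rwa [← eq_of_E0_repeatCoords (hax.trans (E0_flipOn s _).symm)]
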